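/- arXiv:1612.04065 — 3 statements merged into one kernel-verified Lean document; each statement's English description precedes it below -/
import Mathlib

section
/- Let S be a finite set of transmitter indices, let h : S → ℝ with h_m ≥ 0 for all m ∈ S (channel gain magnitudes), let σ² > 0 be the noise power, let B > 0 be the bandwidth, and let N be a positive integer. Define the rate function r : (S → ℝ) → ℝ by r(p) = (B/N) · log₂(1 + (1/σ²) · (∑_{m∈S} h_m · √(p_m))²). Then r is concave on the nonnegative orthant {p : S → ℝ | p_m ≥ 0 for all m ∈ S}, i.e., jointly concave with respect to the powers p_m. -/
/-- The geometric mean of two variables is concave on the nonnegative quadrant. -/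
theorem concaveOn_sqrt_mul_sqrt :
    ConcaveOn ℝ {q : ℝ × ℝ | 0 ≤ q.1 ∧ 0 ≤ q.2} (fun q => √q.1 * √q.2) := by
  refine ⟨?_, ?_⟩
  · rintro x ⟨hx₁, hx₂⟩ y ⟨hy₁, hy₂⟩ a b ha hb -
    exact ⟨add_nonneg (mul_nonneg ha hx₁) (mul_nonneg hb hy₁),
      add_nonneg (mul_nonneg ha hx₂) (mul_nonneg hb hy₂)⟩
  · rintro ⟨x₁, x₂⟩ ⟨hx₁, hx₂⟩ ⟨y₁, y₂⟩ ⟨hy₁, hy₂⟩ a b ha hb -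
    simp only [Prod.smul_mk, Prod.mk_add_mk, smul_eq_mul] at *
    rw [← Real.sqrt_mul (x := a * x₁ + b * y₁) (by positivity)]
    apply Real.le_sqrt_of_sq_le
    obtain ⟨u₁, -, rfl⟩ : ∃ u, 0 ≤ u ∧ u ^ 2 = x₁ := ⟨√x₁, Real.sqrt_nonneg _, Real.sq_sqrt hx₁⟩
    obtain ⟨u₂, -, rfl⟩ : ∃ u, 0 ≤ u ∧ u ^ 2 = x₂ := ⟨√x₂, Real.sqrt_nonneg _, Real.sq_sqrt hx₂⟩
    obtain ⟨v₁, -, rfl⟩ : ∃ u, 0 ≤ u ∧ u ^ 2 = y₁ := ⟨√y₁, Real.sqrt_nonneg _, Real.sq_sqrt hy₁⟩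
    obtain ⟨v₂, -, rfl⟩ : ∃ u, 0 ≤ u ∧ u ^ 2 = y₂ := ⟨√y₂, Real.sqrt_nonneg _, Real.sq_sqrt hy₂⟩
    simp only [Real.sqrt_sq_eq_abs]
    have key := mul_nonneg (mul_nonneg ha hb) (sq_nonneg (|u₁| * |v₂| - |v₁| * |u₂|))
    rw [← sq_abs u₁, ← sq_abs u₂, ← sq_abs v₁, ← sq_abs v₂]
    linarith

/-- A finite sum of concave functions is concave. -/
theorem concaveOn_finset_sum {ι E : Type*} [AddCommGroup E] [Module ℝ E] {s : Set E}
    (hs : Convex ℝ s) (t : Finset ι) {f : ι → E → ℝ} (hf : ∀ i ∈ t, ConcaveOn ℝ s (f i)) :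
    ConcaveOn ℝ s (fun x => ∑ i ∈ t, f i x) := by
  refine ⟨hs, fun x hx y hy a b ha hb hab => ?_⟩
  simp only [Finset.smul_sum, ← Finset.sum_add_distrib]
  exact Finset.sum_le_sum fun i hi => (hf i hi).2 hx hy ha hb hab

/-- The logarithm of a positive concave function is concave. -/
theorem ConcaveOn.log_of_pos {E : Type*} [AddCommGroup E] [Module ℝ E] {s : Set E} {f : E → ℝ}
    (hf : ConcaveOn ℝ s f) (hpos : ∀ x ∈ s, 0 < f x) :
    ConcaveOn ℝ s (fun x => Real.log (f x)) := by
  refine ⟨hf.1, fun x hx y hy a b ha hb hab => ?_⟩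
  have hmem := strictConcaveOn_log_Ioi.1 (hpos x hx) (hpos y hy) ha hb hab
  exact (strictConcaveOn_log_Ioi.concaveOn.2 (hpos x hx) (hpos y hy) ha hb hab).trans
    (Real.log_le_log hmem (hf.2 hx hy ha hb hab))

theorem convex_nonneg_orthant (S : Type*) : Convex ℝ {p : S → ℝ | ∀ m, 0 ≤ p m} :=
  fun _ hx _ hy _ _ ha hb _ m => add_nonneg (mul_nonneg ha (hx m)) (mul_nonneg hb (hy m))

/-- The square of a nonnegative combination of square roots is concave. -/
theorem concaveOn_sq_sum_mul_sqrt {S : Type*} [Fintype S] {h : S → ℝ} (hh : ∀ m, 0 ≤ h m) :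
    ConcaveOn ℝ {p : S → ℝ | ∀ m, 0 ≤ p m} (fun p => (∑ m, h m * √(p m)) ^ 2) := by
  have hs := convex_nonneg_orthant S
  have hpair (i j : S) :
      ConcaveOn ℝ {p : S → ℝ | ∀ m, 0 ≤ p m} (fun p => √(p i) * √(p j)) :=
    (concaveOn_sqrt_mul_sqrt.comp_linearMap
      ((LinearMap.proj i : (S → ℝ) →ₗ[ℝ] ℝ).prod (LinearMap.proj j))).subset
        (fun _ hp => ⟨hp i, hp j⟩) hs
  refine (concaveOn_finset_sum hs Finset.univ fun i _ =>
    concaveOn_finset_sum hs Finset.univ fun j _ =>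
      (hpair i j).smul (mul_nonneg (hh i) (hh j))).congr fun p _ => ?_
  simp only [sq, Finset.sum_mul_sum, smul_eq_mul]
  exact Finset.sum_congr rfl fun i _ => Finset.sum_congr rfl fun j _ => by ring

/-- Lemma 1: the achievable rate r(p) = (B/N) · log₂(1 + (1/σ²)(∑_{m∈S} h_m √(p_m))²)
is jointly concave in the transmit powers on the nonnegative orthant. -/
theorem rate_concave_on_nonneg_orthant
    (S : Type*) [Fintype S] (h : S → ℝ) (hh : ∀ m, 0 ≤ h m)
    (σ2 : ℝ) (hσ2 : 0 < σ2) (B : ℝ) (hB : 0 < B) (N : ℕ) (hN : 0 < N) :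
    ConcaveOn ℝ {p : S → ℝ | ∀ m, 0 ≤ p m}
      (fun p : S → ℝ =>
        (B / (N : ℝ)) *
          Real.logb 2 (1 + (1 / σ2) * (∑ m, h m * Real.sqrt (p m)) ^ 2)) := by
  have hsnr := ((concaveOn_sq_sum_mul_sqrt hh).smul (one_div_pos.2 hσ2).le).add_const 1
  have hlog := hsnr.log_of_pos fun p _ => by
    simp only [smul_eq_mul, Pi.add_apply]
    positivity
  refine (hlog.smul (c := B / N / Real.log 2) (by positivity)).congr fun p _ => ?_
  simp only [smul_eq_mul, Real.logb, Pi.add_apply, add_comm]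
  ring
end

section
/- Let S be a nonempty finite set of selected transmitters, h : S → ℝ with h_m ≥ 0 for all m ∈ S and h_m > 0 for at least one m, σ² > 0, B > 0, N a positive integer, and F ∈ ℝ. Define G = ∑_{m∈S} h_m²/σ², and define the objective J : (S → ℝ) → ℝ by J(p) = ∑_{m∈S} p_m − F · (B/N) · log₂(1 + (1/σ²) · (∑_{m∈S} h_m √(p_m))²). Then the point p̃ given by p̃_m = max(0, B·F·G/(N·ln 2) − 1) · h_m² / (G² · σ²) for each m ∈ S minimizes J over the nonnegative orthant, i.e., J(p̃) ≤ J(p) for every p with p_m ≥ 0 for all m ∈ S. -/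
/-- The scalar water-filling problem: `t = [u - 1]⁺` minimizes `t - u * log (1 + t)` over `t ≥ 0`. -/
lemma max_sub_mul_log_one_add_le (u : ℝ) {x : ℝ} (hx : 0 ≤ x) :
    max 0 (u - 1) - u * Real.log (1 + max 0 (u - 1)) ≤ x - u * Real.log (1 + x) := by
  rcases le_total u 1 with hu | hu
  · rw [max_eq_left (by linarith)]
    have hlog : Real.log (1 + x) ≤ x := by
      linarith [Real.log_le_sub_one_of_pos (show 0 < 1 + x by linarith)]
    have hlog0 : 0 ≤ Real.log (1 + x) := Real.log_nonneg (by linarith)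
    simp only [add_zero, Real.log_one, mul_zero, sub_zero]
    nlinarith [mul_nonneg (sub_nonneg.2 hu) hlog0]
  · have hu0 : 0 < u := by linarith
    have hx1 : 0 < 1 + x := by linarith
    rw [max_eq_right (by linarith), add_sub_cancel]
    have hlog := Real.log_le_sub_one_of_pos (div_pos hx1 hu0)
    rw [Real.log_div hx1.ne' hu0.ne'] at hlog
    have hmul := mul_le_mul_of_nonneg_left hlog hu0.le
    have hcancel : u * ((1 + x) / u - 1) = 1 + x - u := by field_simp
    linarith

/-- Cauchy–Schwarz for a sum of weighted square roots. -/
lemma sq_sum_mul_sqrt_le {ι : Type*} [Fintype ι] (h p : ι → ℝ) (hp : ∀ i, 0 ≤ p i) :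
    (∑ i, h i * Real.sqrt (p i)) ^ 2 ≤ (∑ i, h i ^ 2) * ∑ i, p i := by
  simpa only [Real.sq_sqrt (hp _)] using
    Finset.sum_mul_sq_le_sq_mul_sq Finset.univ h fun i => Real.sqrt (p i)

/-- Equality in Cauchy–Schwarz when the weights under the roots are proportional to `h ^ 2`. -/
lemma sq_sum_mul_sqrt_mul_sq {ι : Type*} [Fintype ι] (h : ι → ℝ) (hh : ∀ i, 0 ≤ h i)
    {c : ℝ} (hc : 0 ≤ c) :
    (∑ i, h i * Real.sqrt (c * h i ^ 2)) ^ 2 = c * (∑ i, h i ^ 2) ^ 2 := by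
  have hterm : ∀ i, h i * Real.sqrt (c * h i ^ 2) = Real.sqrt c * h i ^ 2 := fun i => by
    rw [Real.sqrt_mul hc, Real.sqrt_sq (hh i)]
    ring
  simp only [hterm]
  rw [← Finset.mul_sum, mul_pow, Real.sq_sqrt hc]


/-- Proposition 1: the power allocation
p̃_m = [B·F·G/(N ln 2) − 1]⁺ · h_m²/(G²σ²), with G = ∑_{m∈S} h_m²/σ²,
minimizes J(p) = ∑_m p_m − F·(B/N)·log₂(1 + (1/σ²)(∑_m h_m √(p_m))²)
over the nonnegative orthant. -/
theorem opt_power_allocation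
    (S : Type*) [Fintype S] [Nonempty S]
    (h : S → ℝ) (hh : ∀ m, 0 ≤ h m) (hpos : ∃ m, 0 < h m)
    (σ2 : ℝ) (hσ2 : 0 < σ2) (B : ℝ) (hB : 0 < B) (N : ℕ) (hN : 0 < N) (F : ℝ)
    (G : ℝ) (hG : G = ∑ m, h m ^ 2 / σ2)
    (J : (S → ℝ) → ℝ)
    (hJ : ∀ p, J p = (∑ m, p m) -
      F * ((B / (N : ℝ)) *
        Real.logb 2 (1 + (1 / σ2) * (∑ m, h m * Real.sqrt (p m)) ^ 2)))
    (ptilde : S → ℝ)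
    (hpt : ∀ m, ptilde m =
      max 0 (B * F * G / ((N : ℝ) * Real.log 2) - 1) * (h m ^ 2 / (G ^ 2 * σ2))) :
    ∀ p : S → ℝ, (∀ m, 0 ≤ p m) → J ptilde ≤ J p := by
  intro p hp
  obtain ⟨m₀, hm₀⟩ := hpos
  have hsum : ∑ m, h m ^ 2 = G * σ2 := by
    rw [hG, ← Finset.sum_div, div_mul_cancel₀ _ hσ2.ne']
  have hGσ : 0 < G * σ2 := by
    rw [← hsum]
    exact Finset.sum_pos' (fun m _ => sq_nonneg _) ⟨m₀, Finset.mem_univ _, pow_pos hm₀ 2⟩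
  have hG0 : 0 < G := pos_of_mul_pos_left hGσ hσ2.le
  have hN0 : (0 : ℝ) < N := Nat.cast_pos.2 hN
  have hlog2 : 0 < Real.log 2 := Real.log_pos one_lt_two
  set u := B * F * G / ((N : ℝ) * Real.log 2) with hu
  set t := max 0 (u - 1) with ht
  have ht0 : 0 ≤ t := le_max_left _ _
  have hobj : ∀ q, J q = (∑ m, q m) -
      u * Real.log (1 + (1 / σ2) * (∑ m, h m * Real.sqrt (q m)) ^ 2) / G := fun q => by
    rw [hJ, hu, Real.logb]
    field_simp
  have hpt' : ∀ m, ptilde m = t / (G ^ 2 * σ2) * h m ^ 2 := fun m => by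
    rw [hpt]
    ring
  have hptsum : ∑ m, ptilde m = t / G := by
    simp only [hpt']
    rw [← Finset.mul_sum, hsum]
    field_simp
  have hptgain : (1 / σ2) * (∑ m, h m * Real.sqrt (ptilde m)) ^ 2 = t := by
    simp only [hpt']
    rw [sq_sum_mul_sqrt_mul_sq h hh (by positivity), hsum]
    field_simp
  have hcs := sq_sum_mul_sqrt_le h p hp
  rw [hsum] at hcs
  rw [hobj, hobj, hptsum, hptgain]
  set x := (1 / σ2) * (∑ m, h m * Real.sqrt (p m)) ^ 2 with hx
  have hx0 : 0 ≤ x := by positivity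
  have hxle : x / G ≤ ∑ m, p m := by
    rw [hx, div_le_iff₀ hG0, one_div_mul_eq_div, div_le_iff₀ hσ2]
    linarith
  have hscalar := div_le_div_of_nonneg_right (max_sub_mul_log_one_add_le u hx0) hG0.le
  rw [← ht, sub_div, sub_div] at hscalar
  linarith
end

section
/- Let S be a nonempty finite set, h : S → ℝ with h_m ≥ 0 for all m ∈ S, σ² > 0, B > 0, N a positive integer, and F ∈ ℝ. Define G = ∑_{m∈S} h_m²/σ² and J(p) = ∑_{m∈S} p_m − F · (B/N) · log₂(1 + (1/σ²) · (∑_{m∈S} h_m √(p_m))²). If F · G ≤ (N · ln 2)/B, then the all-zero power vector p = 0 minimizes J over the nonnegative orthant: J(0) ≤ J(p) for every p with p_m ≥ 0 for all m ∈ S. -/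
/-- Threshold structure in Proposition 1: if F·G ≤ (N ln 2)/B, the all-zero power
vector minimizes J(p) = ∑_m p_m − F·(B/N)·log₂(1 + (1/σ²)(∑_m h_m √(p_m))²)
over the nonnegative orthant. -/
theorem zero_power_optimal_below_threshold
    (S : Type*) [Fintype S] [Nonempty S]
    (h : S → ℝ) (hh : ∀ m, 0 ≤ h m)
    (σ2 : ℝ) (hσ2 : 0 < σ2) (B : ℝ) (hB : 0 < B) (N : ℕ) (hN : 0 < N) (F : ℝ)
    (G : ℝ) (hG : G = ∑ m, h m ^ 2 / σ2)
    (J : (S → ℝ) → ℝ)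
    (hJ : ∀ p, J p = (∑ m, p m) -
      F * ((B / (N : ℝ)) *
        Real.logb 2 (1 + (1 / σ2) * (∑ m, h m * Real.sqrt (p m)) ^ 2)))
    (hthr : F * G ≤ ((N : ℝ) * Real.log 2) / B) :
    ∀ p : S → ℝ, (∀ m, 0 ≤ p m) → J (fun _ => 0) ≤ J p := by
  intro p hp
  have hN' : (0 : ℝ) < N := Nat.cast_pos.mpr hN
  have hlog : 0 < Real.log 2 := Real.log_pos one_lt_two
  have hP : 0 ≤ ∑ m, p m := Finset.sum_nonneg fun m _ => hp m
  have hJ0 : J (fun _ => 0) = 0 := by simp [hJ]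
  rw [hJ0, hJ, sub_nonneg]
  set x := (1 / σ2) * (∑ m, h m * Real.sqrt (p m)) ^ 2 with hx
  have hx0 : 0 ≤ x := by positivity
  have hxG : x ≤ G * ∑ m, p m := by
    have hcs := Finset.sum_mul_sq_le_sq_mul_sq Finset.univ h fun m => Real.sqrt (p m)
    simp only [Real.sq_sqrt (hp _)] at hcs
    calc x ≤ (1 / σ2) * ((∑ m, h m ^ 2) * ∑ m, p m) :=
          mul_le_mul_of_nonneg_left hcs (by positivity)
      _ = G * ∑ m, p m := by rw [hG, ← Finset.sum_div]; ring
  rcases le_total F 0 with hF | hF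
  · have hrate : 0 ≤ B / (N : ℝ) * Real.logb 2 (1 + x) :=
      mul_nonneg (by positivity) (Real.logb_nonneg one_lt_two (by linarith))
    exact (mul_nonpos_of_nonpos_of_nonneg hF hrate).trans hP
  · have hlogx : Real.log (1 + x) ≤ G * ∑ m, p m := by
      linarith [Real.log_le_sub_one_of_pos (show 0 < 1 + x by linarith)]
    calc F * (B / (N : ℝ) * Real.logb 2 (1 + x))
        = F * (B / (N * Real.log 2)) * Real.log (1 + x) := by
          rw [Real.logb]; field_simp
      _ ≤ F * (B / (N * Real.log 2)) * (G * ∑ m, p m) :=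
          mul_le_mul_of_nonneg_left hlogx (by positivity)
      _ = F * G * (B / (N * Real.log 2) * ∑ m, p m) := by ring
      _ ≤ N * Real.log 2 / B * (B / (N * Real.log 2) * ∑ m, p m) :=
          mul_le_mul_of_nonneg_right hthr (by positivity)
      _ = ∑ m, p m := by field_simp
end
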